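/- Let k ≥ 1, let C₁, …, C_{2k} ∈ ℝ^{p×q} be real matrices, and fix distinct indices l, m ∈ {1, …, 2k}. Suppose there is a partition of {1, …, 2k} into k two-element groups G₁, …, G_k, say G_i = {g_i(1), g_i(2)}, such that for every i = 1, …, k: C_lᵀ C_{g_i(1)} = C_mᵀ C_{g_i(2)} and C_mᵀ C_{g_i(1)} = −C_lᵀ C_{g_i(2)}. Then for all vectors h⁽¹⁾ ∈ ℝ^q and h⁽²⁾ ∈ ℝ^q, Σ_{j=1}^{2k} ( (h⁽²⁾)ᵀ C_lᵀ C_j h⁽¹⁾ ) · ( (h⁽²⁾)ᵀ C_mᵀ C_j h⁽¹⁾ ) = 0. -/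

import Mathlib

open Matrix

/-- STATEMENT 6 (sufficiency of condition 2) of Theorem 1): if for fixed distinct `l, m`
there is a partition of `{1, …, 2k}` into `k` two-element groups `G_i = {g_i(1), g_i(2)}`
with `C_lᵀ C_{g_i(1)} = C_mᵀ C_{g_i(2)}` and `C_mᵀ C_{g_i(1)} = −C_lᵀ C_{g_i(2)}`, then for
all `h⁽¹⁾, h⁽²⁾ ∈ ℝ^q`,
`Σ_{j=1}^{2k} ((h⁽²⁾)ᵀ C_lᵀ C_j h⁽¹⁾)((h⁽²⁾)ᵀ C_mᵀ C_j h⁽¹⁾) = 0`. -/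
theorem sum_eq_zero_of_k_group_partition (k p q : ℕ) (hk : 1 ≤ k)
    (C : Fin (2 * k) → Matrix (Fin p) (Fin q) ℝ)
    (l m : Fin (2 * k)) (hlm : l ≠ m)
    (hpart : ∃ g : Fin k → Fin (2 * k) × Fin (2 * k),
      Function.Bijective
        (fun x : Fin k × Bool => if x.2 then (g x.1).1 else (g x.1).2) ∧
      ∀ i : Fin k,
        (C l)ᵀ * C ((g i).1) = (C m)ᵀ * C ((g i).2) ∧
        (C m)ᵀ * C ((g i).1) = -((C l)ᵀ * C ((g i).2))) :
    ∀ h₁ h₂ : Fin q → ℝ,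
      ∑ j : Fin (2 * k),
        (h₂ ⬝ᵥ ((C l)ᵀ * C j).mulVec h₁) * (h₂ ⬝ᵥ ((C m)ᵀ * C j).mulVec h₁) = 0 := by
  intro h₁ h₂
  obtain ⟨g, hb, hg⟩ := hpart
  rw [← Function.Bijective.sum_comp hb (fun j =>
    (h₂ ⬝ᵥ ((C l)ᵀ * C j).mulVec h₁) * (h₂ ⬝ᵥ ((C m)ᵀ * C j).mulVec h₁))]
  rw [Fintype.sum_prod_type]
  apply Finset.sum_eq_zero
  intro i _
  obtain ⟨e1, e2⟩ := hg i
  rw [Fintype.sum_bool]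
  simp only [if_true, Bool.false_eq_true, if_false]
  rw [e1, e2, Matrix.neg_mulVec, dotProduct_neg]
  ring
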